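/- There exists σ₁ > 0 such that for every σ > σ₁ there is a right solution V : (0,1] → ℝ with speed σ defined on the whole interval (0,1] and satisfying lim_{u→0⁺} V(u) = 0. -/

import Mathlib

open Set Filter Topology
open scoped ENNReal

noncomputable section

/-- The strip `Ω` between `-ω` and `ω` over `[0,1]`:
`Ω = {(u,s) : u ∈ [0,1], -ω(u) < s < ω(u)}`. -/
def OmegaSet (ω : ℝ → ℝ≥0∞) : Set (ℝ × ℝ) :=
  {p | p.1 ∈ Set.Icc (0:ℝ) 1 ∧ ENNReal.ofReal |p.2| < ω p.1}

/-- The set `𝒟` between `a₋ = -a₊` and `a₊` over `[0,1]`. -/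
def DSet (aplus : ℝ → ℝ≥0∞) : Set (ℝ × ℝ) :=
  {p | p.1 ∈ Set.Icc (0:ℝ) 1 ∧ ENNReal.ofReal |p.2| < aplus p.1}

/-- Standing data and hypotheses: a lower semicontinuous width `ω : [0,1] → (0,∞]`,
a regular flux `a` on `Ω` (odd in `s`, C¹, with `∂a/∂s > 0`), the maximal fluxes
`a₊(u) = lim_{s→ω(u)⁻} a(u,s)` (equivalently, the supremum over `0 < s < ω(u)`),
which are `+∞` whenever `ω(u) < ∞`, the partial inverse `g` on `𝒟` defined by
`a(u, g(u,v)) = v`, and a logistic-type reaction term `f`. -/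
structure FluxData where
  ω : ℝ → ℝ≥0∞
  a : ℝ → ℝ → ℝ
  aplus : ℝ → ℝ≥0∞
  g : ℝ → ℝ → ℝ
  f : ℝ → ℝ
  ω_pos : ∀ u ∈ Set.Icc (0:ℝ) 1, 0 < ω u
  ω_lsc : LowerSemicontinuousOn ω (Set.Icc (0:ℝ) 1)
  a_odd : ∀ u s, (u, s) ∈ OmegaSet ω → a u (-s) = - a u s
  a_C1 : ContDiffOn ℝ 1 (fun p : ℝ × ℝ => a p.1 p.2) (OmegaSet ω)
  a_deriv_pos : ∀ u s, (u, s) ∈ OmegaSet ω → ∃ d : ℝ, 0 < d ∧ HasDerivAt (a u) d s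
  aplus_def : ∀ u ∈ Set.Icc (0:ℝ) 1,
      aplus u = ⨆ s ∈ {s : ℝ | 0 < s ∧ (u, s) ∈ OmegaSet ω}, ENNReal.ofReal (a u s)
  aplus_pos : ∀ u ∈ Set.Icc (0:ℝ) 1, 0 < aplus u
  aplus_top : ∀ u ∈ Set.Icc (0:ℝ) 1, ω u < ⊤ → aplus u = ⊤
  g_spec : ∀ p ∈ DSet aplus, (p.1, g p.1 p.2) ∈ OmegaSet ω ∧ a p.1 (g p.1 p.2) = p.2
  f_C1 : ContDiffOn ℝ 1 f (Set.Icc (0:ℝ) 1)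
  f_zero : f 0 = 0
  f_one : f 1 = 0
  f_pos : ∀ u ∈ Set.Ioo (0:ℝ) 1, 0 < f u

/-- A classic traveling wave of `u_t = (b(u,u_x))_x + f(u)` moving at speed `σ`:
a C² increasing profile `u` with values in `(0,1)`, `0 < u' < ω(u)`, connecting
`0` at `-∞` to `1` at `+∞`, such that `ξ ↦ b(u(ξ),u'(ξ))` is differentiable and
`(b(u,u'))' - σ u' + f(u) = 0`. -/
def IsClassicTW (F : FluxData) (b : ℝ → ℝ → ℝ) (σ : ℝ) (u : ℝ → ℝ) : Prop :=
  ContDiff ℝ 2 u ∧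
  (∀ ξ : ℝ, u ξ ∈ Set.Ioo (0:ℝ) 1) ∧
  (∀ ξ : ℝ, 0 < deriv u ξ ∧ ENNReal.ofReal (deriv u ξ) < F.ω (u ξ)) ∧
  Filter.Tendsto u Filter.atBot (nhds 0) ∧
  Filter.Tendsto u Filter.atTop (nhds 1) ∧
  (∀ ξ : ℝ, HasDerivAt (fun t => b (u t) (deriv u t)) (σ * deriv u ξ - F.f (u ξ)) ξ)

/-- A right solution with speed `σ`: `V : (α,1] → ℝ`, continuous on `(α,1]`,
C¹ on `(α,1)`, `V(1) = 0`, and on `(α,1)` : `V > 0`, `(u,V(u)) ∈ 𝒟` and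
`V' = σ - f(u)/g(u,V(u))`. -/
def IsRightSolution (F : FluxData) (σ α : ℝ) (V : ℝ → ℝ) : Prop :=
  α ∈ Set.Ico (0:ℝ) 1 ∧
  ContinuousOn V (Set.Ioc α 1) ∧
  V 1 = 0 ∧
  ∀ u ∈ Set.Ioo α 1, 0 < V u ∧ (u, V u) ∈ DSet F.aplus ∧
    HasDerivAt V (σ - F.f u / F.g u (V u)) u

open Classical in
/-- `ℋ(u,V) = 1/g(u,V)` if `0 < V < a₊(u)`, and `0` if `V ≥ a₊(u)`. -/
def Hfun (F : FluxData) (u V : ℝ) : ℝ :=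
  if ENNReal.ofReal V < F.aplus u then 1 / F.g u V else 0

/-- The solution `𝒱_σ` of the extended problem: continuous on `[0,1]`, C¹ on `(0,1)`,
`𝒱(1) = 0`, `𝒱 > 0` on `(0,1)` and `𝒱' = σ - f(u)·ℋ(u,𝒱(u))` on `(0,1)`. -/
def IsVsol (F : FluxData) (σ : ℝ) (V : ℝ → ℝ) : Prop :=
  ContinuousOn V (Set.Icc (0:ℝ) 1) ∧ V 1 = 0 ∧
  (∀ u ∈ Set.Ioo (0:ℝ) 1, 0 < V u) ∧
  (∀ u ∈ Set.Ioo (0:ℝ) 1, HasDerivAt V (σ - F.f u * Hfun F u (V u)) u)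

/-- A function that is nonpositive at the right end of an interval, and has nonnegative derivative
wherever it is positive, is nonpositive on the whole interval. -/
lemma nonpos_of_deriv_nonneg_of_pos {φ φ' : ℝ → ℝ} {a b : ℝ}
    (hc : ContinuousOn φ (Icc a b)) (hd : ∀ u ∈ Ioo a b, HasDerivAt φ (φ' u) u)
    (hp : ∀ u ∈ Ioo a b, 0 < φ u → 0 ≤ φ' u) (hb : φ b ≤ 0) :
    ∀ u ∈ Icc a b, φ u ≤ 0 := by
  intro u₀ hu₀
  by_contra! hpos
  have hcompact : IsCompact (Icc u₀ b ∩ φ ⁻¹' Iic 0) :=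
    isCompact_Icc.of_isClosed_subset
      ((hc.mono (Icc_subset_Icc_left hu₀.1)).preimage_isClosed_of_isClosed isClosed_Icc isClosed_Iic)
      inter_subset_left
  obtain ⟨x, ⟨hx, hφx⟩, hmin⟩ := hcompact.exists_isLeast ⟨b, ⟨hu₀.2, le_rfl⟩, hb⟩
  have hsub : Icc u₀ x ⊆ Icc a b := Icc_subset_Icc hu₀.1 hx.2
  have hder : ∀ y ∈ Ioo u₀ x, HasDerivAt φ (φ' y) y := fun y hy =>
    hd y ⟨hu₀.1.trans_lt hy.1, hy.2.trans_le hx.2⟩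
  have hmono : MonotoneOn φ (Icc u₀ x) := by
    refine monotoneOn_of_deriv_nonneg (convex_Icc _ _) (hc.mono hsub) ?_ ?_
    · rw [interior_Icc]
      exact fun y hy => (hder y hy).differentiableAt.differentiableWithinAt
    · rw [interior_Icc]
      intro y hy
      rw [(hder y hy).deriv]
      refine hp y ⟨hu₀.1.trans_lt hy.1, hy.2.trans_le hx.2⟩ ?_
      by_contra! hle
      exact absurd (hmin ⟨⟨hy.1.le, hy.2.le.trans hx.2⟩, hle⟩) (not_le.2 hy.2)
  have := hmono ⟨le_rfl, hx.1⟩ ⟨hx.1, le_rfl⟩ hx.1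
  exact absurd (this.trans hφx) (not_le.2 hpos)

/-- Rates `p(u,v)` on `[0,1] × (0,r]` that blow up like `1/v` as `v → 0` for `u` in the interior,
decrease in `v`, and degenerate at most linearly in `u` near both ends of `[0,1]`. -/
structure IsSingularRate (p : ℝ → ℝ → ℝ) (r C : ℝ) : Prop where
  r_pos : 0 < r
  antitone : ∀ u ∈ Icc (0:ℝ) 1, AntitoneOn (p u) (Ioc 0 r)
  continuousOn : ∀ v ∈ Ioc 0 r, ContinuousOn (fun u => p u v) (Icc 0 1)
  lipschitz : ∀ ε > 0, ∃ L : ℝ, 0 ≤ L ∧ ∀ u ∈ Icc (0:ℝ) 1, ∀ v ∈ Icc ε r, ∀ w ∈ Icc ε r,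
    |p u v - p u w| ≤ L * |v - w|
  nonneg : ∀ u ∈ Icc (0:ℝ) 1, ∀ v ∈ Ioc 0 r, 0 ≤ p u v
  C_nonneg : 0 ≤ C
  mul_le_left : ∀ u ∈ Icc (0:ℝ) 1, ∀ v ∈ Ioc 0 r, p u v * v ≤ C * u
  mul_le_right : ∀ u ∈ Icc (0:ℝ) 1, ∀ v ∈ Ioc 0 r, p u v * v ≤ C * (1 - u)
  exists_le_mul : ∀ c d : ℝ, 0 < c → c ≤ d → d < 1 →
    ∃ k > 0, ∀ u ∈ Icc c d, ∀ v ∈ Ioc 0 r, k ≤ p u v * v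

/-- Truncation of `v` to the interval `[ε, r]`. -/
def truncate (ε r v : ℝ) : ℝ := max ε (min v r)

lemma truncate_mem {ε r : ℝ} (h : ε ≤ r) (v : ℝ) : truncate ε r v ∈ Icc ε r :=
  ⟨le_max_left _ _, max_le h (min_le_right _ _)⟩

lemma truncate_mem_Ioc {ε r : ℝ} (h₀ : 0 < ε) (h : ε ≤ r) (v : ℝ) : truncate ε r v ∈ Ioc 0 r :=
  ⟨h₀.trans_le (truncate_mem h v).1, (truncate_mem h v).2⟩

lemma truncate_of_mem {ε r v : ℝ} (h : v ∈ Icc ε r) : truncate ε r v = v := by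
  rw [truncate, min_eq_left h.2, max_eq_right h.1]

lemma abs_truncate_sub_le (ε r v w : ℝ) : |truncate ε r v - truncate ε r w| ≤ |v - w| := by
  unfold truncate
  refine (abs_max_sub_max_le_max _ _ _ _).trans ?_
  refine max_le (by simp) ((abs_min_sub_min_le_max _ _ _ _).trans (max_le le_rfl (by simp)))

/-- `V` solves `V' = σ - p(u,V)` on `[c,d]`, where `V` is truncated to `[ε,r]` in the rate `p`. -/
def IsTruncatedSol (p : ℝ → ℝ → ℝ) (r σ ε c d : ℝ) (V : ℝ → ℝ) : Prop :=
  ContinuousOn V (Icc c d) ∧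
    ∀ u ∈ Ioo c d, HasDerivAt V (σ - p u (truncate ε r (V u))) u

lemma IsTruncatedSol.mono {p : ℝ → ℝ → ℝ} {r σ ε c d c' d' : ℝ} {V : ℝ → ℝ}
    (h : IsTruncatedSol p r σ ε c d V) (hc : c ≤ c') (hd : d' ≤ d) :
    IsTruncatedSol p r σ ε c' d' V :=
  ⟨h.1.mono (Icc_subset_Icc hc hd), fun u hu => h.2 u (Ioo_subset_Ioo hc hd hu)⟩

namespace IsSingularRate

variable {p : ℝ → ℝ → ℝ} {r C : ℝ}

lemma le_div (hp : IsSingularRate p r C) {ε u v : ℝ} (hε : 0 < ε) (hu : u ∈ Icc (0:ℝ) 1)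
    (hv : v ∈ Icc ε r) : p u v ≤ C / ε := by
  have hv' : v ∈ Ioc 0 r := ⟨hε.trans_le hv.1, hv.2⟩
  rw [le_div_iff₀ hε]
  calc p u v * ε ≤ p u v * v := mul_le_mul_of_nonneg_left hv.1 (hp.nonneg u hu v hv')
    _ ≤ C * u := hp.mul_le_left u hu v hv'
    _ ≤ C := mul_le_of_le_one_right hp.C_nonneg hu.2

lemma exists_truncatedSol (hp : IsSingularRate p r C) {ε d : ℝ} (σ y : ℝ) (hε : 0 < ε)
    (hεr : ε ≤ r) (hd : d ∈ Icc (0:ℝ) 1) :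
    ∃ V : ℝ → ℝ, V d = y ∧ IsTruncatedSol p r σ ε 0 1 V := by
  obtain ⟨K, hK, hLip⟩ := hp.lipschitz ε hε
  have hB : 0 ≤ |σ| + C / ε := add_nonneg (abs_nonneg _) (div_nonneg hp.C_nonneg hε.le)
  have hPL : IsPicardLindelof (fun u v => σ - p u (truncate ε r v))
      (⟨d, hd⟩ : Icc (0:ℝ) 1) y ⟨|σ| + C / ε, hB⟩ 0 ⟨|σ| + C / ε, hB⟩ ⟨K, hK⟩ := by
    refine ⟨fun t ht => ?_, fun x _ => ?_, fun t ht x _ => ?_, ?_⟩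
    · refine LipschitzOnWith.of_dist_le_mul fun v _ w _ => ?_
      rw [Real.dist_eq, Real.dist_eq, sub_sub_sub_cancel_left, abs_sub_comm]
      exact (hLip t ht _ (truncate_mem hεr v) _ (truncate_mem hεr w)).trans
        (mul_le_mul_of_nonneg_left (abs_truncate_sub_le _ _ _ _) hK)
    · exact continuousOn_const.sub (hp.continuousOn _ (truncate_mem_Ioc hε hεr x))
    · have h1 := hp.nonneg t ht _ (truncate_mem_Ioc hε hεr x)
      have h2 := hp.le_div hε ht (truncate_mem hεr x)
      refine (abs_sub _ _).trans ?_
      rw [abs_of_nonneg h1]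
      exact add_le_add le_rfl h2
    · have h : max (1 - d) (d - 0) ≤ 1 := max_le (by linarith [hd.1]) (by linarith [hd.2])
      exact (mul_le_of_le_one_right hB h).trans_eq (sub_zero _).symm
  obtain ⟨V, hV, hder⟩ := hPL.exists_eq_forall_mem_Icc_hasDerivWithinAt₀
  exact ⟨V, hV, fun t ht => (hder t ht).continuousWithinAt,
    fun t ht => (hder t (Ioo_subset_Icc_self ht)).hasDerivAt (Icc_mem_nhds ht.1 ht.2)⟩

/-- Comparison of truncated solutions to the left of a point `d`. -/
lemma truncatedSol_le_add (hp : IsSingularRate p r C) {σ ε₁ ε₂ c d e : ℝ} {V W : ℝ → ℝ}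
    (hε₂ : 0 < ε₂) (hε : ε₂ ≤ ε₁) (hr : ε₁ ≤ r) (hc : 0 ≤ c) (hd : d ≤ 1)
    (hV : IsTruncatedSol p r σ ε₁ c d V) (hW : IsTruncatedSol p r σ ε₂ c d W)
    (he : 0 ≤ e) (hVW : V d ≤ W d + e) : ∀ u ∈ Icc c d, V u ≤ W u + e := by
  have key := nonpos_of_deriv_nonneg_of_pos (φ := fun u => V u - (W u + e))
    (φ' := fun u => (σ - p u (truncate ε₁ r (V u))) - (σ - p u (truncate ε₂ r (W u))))
    (hV.1.sub (hW.1.add continuousOn_const))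
    (fun u hu => (hV.2 u hu).sub ((hW.2 u hu).add_const e)) ?_ (by linarith)
  · intro u hu
    have := key u hu
    linarith
  · intro u hu hpos
    have hle : truncate ε₂ r (W u) ≤ truncate ε₁ r (V u) :=
      max_le_max hε (min_le_min_right r (by linarith))
    have := hp.antitone u ⟨hc.trans hu.1.le, hu.2.le.trans hd⟩
      (truncate_mem_Ioc hε₂ (hε.trans hr) (W u)) (truncate_mem_Ioc (hε₂.trans_le hε) hr (V u)) hle
    linarith

lemma truncatedSol_le_left (hp : IsSingularRate p r C) {σ ε : ℝ} {V : ℝ → ℝ}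
    (hσ : r + C / r < σ) (hε : 0 < ε) (hεr : ε ≤ r) (hV : IsTruncatedSol p r σ ε 0 1 V)
    (hV1 : V 1 = 0) : ∀ u ∈ Icc (0:ℝ) 1, V u ≤ r * u := by
  have hr := hp.r_pos
  have key := nonpos_of_deriv_nonneg_of_pos (φ := fun u => V u - r * u)
    (φ' := fun u => (σ - p u (truncate ε r (V u))) - r * 1)
    (hV.1.sub (by fun_prop))
    (fun u hu => (hV.2 u hu).sub ((hasDerivAt_id u).const_mul r)) ?_ (by linarith)
  · intro u hu
    have := key u hu
    linarith
  · intro u hu hpos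
    have hmem := truncate_mem_Ioc hε hεr (V u)
    have hu' := Ioo_subset_Icc_self hu
    have hle : r * u ≤ truncate ε r (V u) :=
      le_max_of_le_right (le_min (by linarith) (mul_le_of_le_one_right hr.le hu.2.le))
    have h1 := hp.mul_le_left u hu' _ hmem
    have h2 : p u (truncate ε r (V u)) * (r * u) ≤ C * u :=
      (mul_le_mul_of_nonneg_left hle (hp.nonneg u hu' _ hmem)).trans h1
    have h3 : p u (truncate ε r (V u)) ≤ C / r := by
      rw [le_div_iff₀ hr]
      exact le_of_mul_le_mul_right (by linarith) hu.1
    linarith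

lemma truncatedSol_le_right (hp : IsSingularRate p r C) {σ ε : ℝ} {V : ℝ → ℝ}
    (hσ : r + C / r < σ) (hε : 0 < ε) (hεr : ε ≤ r) (hV : IsTruncatedSol p r σ ε 0 1 V)
    (hV1 : V 1 = 0) : ∀ u ∈ Icc (0:ℝ) 1, V u ≤ r * (1 - u) := by
  have hr := hp.r_pos
  have key := nonpos_of_deriv_nonneg_of_pos (φ := fun u => V u - r * (1 - u))
    (φ' := fun u => (σ - p u (truncate ε r (V u))) - r * (-1))
    (hV.1.sub (by fun_prop))
    (fun u hu => (hV.2 u hu).sub (((hasDerivAt_id u).const_sub 1).const_mul r)) ?_ (by linarith)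
  · intro u hu
    have := key u hu
    linarith
  · intro u hu hpos
    have hmem := truncate_mem_Ioc hε hεr (V u)
    have hu' := Ioo_subset_Icc_self hu
    have hle : r * (1 - u) ≤ truncate ε r (V u) :=
      le_max_of_le_right (le_min (by linarith)
        (mul_le_of_le_one_right hr.le (by linarith [hu.1])))
    have h1 := hp.mul_le_right u hu' _ hmem
    have h2 : p u (truncate ε r (V u)) * (r * (1 - u)) ≤ C * (1 - u) :=
      (mul_le_mul_of_nonneg_left hle (hp.nonneg u hu' _ hmem)).trans h1
    have h3 : p u (truncate ε r (V u)) ≤ C / r := by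
      rw [le_div_iff₀ hr]
      exact le_of_mul_le_mul_right (by linarith) (sub_pos.2 hu.2)
    linarith

/-- Truncated solutions are bounded below on compact subintervals of `(0,1)`, uniformly in the
truncation level. -/
lemma exists_le_truncatedSol (hp : IsSingularRate p r C) {σ c d : ℝ} (hσ : 0 < σ)
    (hc : 0 < c) (hcd : c ≤ d) (hd : d < 1) :
    ∃ η > 0, η ≤ r ∧ ∀ ε > 0, ε ≤ η → ∀ V : ℝ → ℝ, IsTruncatedSol p r σ ε 0 1 V → V 1 = 0 →
      ∀ u ∈ Icc c d, η ≤ V u := by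
  have hr := hp.r_pos
  obtain ⟨b, hdb, hb⟩ := exists_between hd
  obtain ⟨k, hk, hkp⟩ := hp.exists_le_mul c b hc (hcd.trans hdb.le) hb
  set S : ℝ := (r + σ) / (b - d) with hS
  have hbd : 0 < b - d := sub_pos.2 hdb
  have hS0 : 0 < S := div_pos (by linarith) hbd
  refine ⟨min r (k / (S + σ)), lt_min hr (div_pos hk (by linarith)), min_le_left _ _, ?_⟩
  set η := min r (k / (S + σ)) with hη
  have hη0 : 0 < η := lt_min hr (div_pos hk (by linarith))
  have hηr : η ≤ r := min_le_left _ _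
  have hηk : η * (S + σ) ≤ k := by
    rw [← le_div_iff₀ (by linarith)]
    exact min_le_right _ _
  intro ε hε hεη V hV hV1
  have hlow : ∀ u ∈ Icc (0:ℝ) 1, σ * (u - 1) ≤ V u := by
    have key := nonpos_of_deriv_nonneg_of_pos (φ := fun u => σ * (u - 1) - V u)
      (φ' := fun u => σ * 1 - (σ - p u (truncate ε r (V u))))
      (ContinuousOn.sub (by fun_prop) hV.1)
      (fun u hu => (((hasDerivAt_id u).sub_const 1).const_mul σ).sub (hV.2 u hu)) ?_
      (by simp [hV1])
    · intro u hu
      have := key u hu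
      linarith
    · intro u hu _
      have := hp.nonneg u (Ioo_subset_Icc_self hu) _
        (truncate_mem_Ioc hε (hεη.trans hηr) (V u))
      linarith
  intro u hu
  have hVb : -σ ≤ V b := by
    have := hlow b ⟨by linarith, hb.le⟩
    nlinarith
  have hub : u ≤ b := hu.2.trans hdb.le
  have hV' : IsTruncatedSol p r σ ε u b V := hV.mono (by linarith [hu.1]) hb.le
  have key := nonpos_of_deriv_nonneg_of_pos (φ := fun x => (η - S * (x - u)) - V x)
    (φ' := fun x => -(S * 1) - (σ - p x (truncate ε r (V x))))
    (ContinuousOn.sub (by fun_prop) hV'.1)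
    (fun x hx => ((((hasDerivAt_id x).sub_const u).const_mul S).const_sub η).sub (hV'.2 x hx))
    ?_ ?_ u ⟨le_rfl, hub⟩
  · simp only [sub_self, mul_zero] at key
    linarith
  · intro x hx hpos
    have hxcb : x ∈ Icc c b := ⟨hu.1.trans hx.1.le, hx.2.le⟩
    have hx01 : x ∈ Icc (0:ℝ) 1 := ⟨hc.le.trans hxcb.1, hxcb.2.trans hb.le⟩
    have hmem := truncate_mem_Ioc hε (hεη.trans hηr) (V x)
    have hVη : V x ≤ η := by nlinarith [hx.1]
    have htr : truncate ε r (V x) ≤ η := max_le hεη ((min_le_left _ _).trans hVη)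
    have h1 := hkp x hxcb _ hmem
    have h2 := mul_le_mul_of_nonneg_left htr (hp.nonneg x hx01 _ hmem)
    have h3 : S + σ ≤ p x (truncate ε r (V x)) :=
      le_of_mul_le_mul_right (by linarith) hη0
    linarith
  · have h1 : S * (b - d) = r + σ := by rw [hS]; field_simp
    have h2 : S * (b - d) ≤ S * (b - u) :=
      mul_le_mul_of_nonneg_left (by linarith [hu.2]) hS0.le
    linarith

/-- For a singular rate `p` and large speed `σ`, the equation `V' = σ - p(u,V)` has a solution on
`(0,1)` that is positive there and vanishes at both ends. -/
theorem exists_solution (hp : IsSingularRate p r C) {σ : ℝ} (hσ : r + C / r < σ) :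
    ∃ V : ℝ → ℝ, V 1 = 0 ∧ ContinuousOn V (Ioc 0 1) ∧ Tendsto V (𝓝[>] 0) (𝓝 0) ∧
      ∀ u ∈ Ioo (0:ℝ) 1, V u ∈ Ioo 0 r ∧ HasDerivAt V (σ - p u (V u)) u := by
  have hr := hp.r_pos
  have hσ0 : 0 < σ := lt_of_le_of_lt (add_nonneg hr.le (div_nonneg hp.C_nonneg hr.le)) hσ
  set ε : ℕ → ℝ := fun n => r / (n + 1) with hε
  have hε0 : ∀ n, 0 < ε n := fun n => by positivity
  have hεanti : Antitone ε := fun m n hmn => by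
    simp only [hε]
    gcongr
  have hεr : ∀ n, ε n ≤ r := fun n => by
    simpa [hε] using hεanti (Nat.zero_le n)
  have hεlim : Tendsto ε atTop (𝓝 0) := by
    simpa [hε, div_eq_mul_inv] using
      (tendsto_one_div_add_atTop_nhds_zero_nat (𝕜 := ℝ)).const_mul r
  choose W hW1 hW using fun n =>
    hp.exists_truncatedSol σ 0 (hε0 n) (hεr n) (right_mem_Icc.2 zero_le_one)
  have hmono : ∀ u ∈ Icc (0:ℝ) 1, Monotone fun n => W n u := fun u hu m n hmn => by
    simpa using hp.truncatedSol_le_add (hε0 n) (hεanti hmn) (hεr m) le_rfl le_rfl (hW m) (hW n)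
      le_rfl (by rw [hW1, hW1, add_zero]) u hu
  have hleft : ∀ n, ∀ u ∈ Icc (0:ℝ) 1, W n u ≤ r * u := fun n =>
    hp.truncatedSol_le_left hσ (hε0 n) (hεr n) (hW n) (hW1 n)
  have hright : ∀ n, ∀ u ∈ Icc (0:ℝ) 1, W n u ≤ r * (1 - u) := fun n =>
    hp.truncatedSol_le_right hσ (hε0 n) (hεr n) (hW n) (hW1 n)
  set V : ℝ → ℝ := fun u => ⨆ n, W n u with hVdef
  have hlim : ∀ u ∈ Icc (0:ℝ) 1, Tendsto (fun n => W n u) atTop (𝓝 (V u)) := fun u hu =>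
    tendsto_atTop_ciSup (hmono u hu) ⟨r * u, by rintro _ ⟨n, rfl⟩; exact hleft n u hu⟩
  have hVleft : ∀ u ∈ Icc (0:ℝ) 1, V u ≤ r * u := fun u hu =>
    le_of_tendsto' (hlim u hu) fun n => hleft n u hu
  have hVright : ∀ u ∈ Icc (0:ℝ) 1, V u ≤ r * (1 - u) := fun u hu =>
    le_of_tendsto' (hlim u hu) fun n => hright n u hu
  have hV1 : V 1 = 0 := by simp [hVdef, hW1]
  have hsol : ∀ u ∈ Ioo (0:ℝ) 1, V u ∈ Ioo 0 r ∧ HasDerivAt V (σ - p u (V u)) u := by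
    intro u hu
    obtain ⟨c, hc0, hcu⟩ := exists_between hu.1
    obtain ⟨d, hud, hd1⟩ := exists_between hu.2
    have hsub : Icc c d ⊆ Icc (0:ℝ) 1 := Icc_subset_Icc hc0.le hd1.le
    have hcd : c ≤ d := (hcu.trans hud).le
    obtain ⟨η, hη0, hηr, hη⟩ := hp.exists_le_truncatedSol hσ0 hc0 hcd hd1
    have hev : ∀ᶠ n in atTop, ε n ≤ η := (hεlim.eventually_lt_const hη0).mono fun n => le_of_lt
    have hWη : ∀ n, ε n ≤ η → ∀ x ∈ Icc c d, W n x ∈ Icc η r := fun n hn x hx =>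
      ⟨hη (ε n) (hε0 n) hn (W n) (hW n) (hW1 n) x hx,
        (hleft n x (hsub hx)).trans (mul_le_of_le_one_right hr.le (hsub hx).2)⟩
    have hVη : ∀ x ∈ Icc c d, V x ∈ Icc η r := fun x hx =>
      isClosed_Icc.mem_of_tendsto (hlim x (hsub hx)) (hev.mono fun n hn => hWη n hn x hx)
    have hWsol : ∀ n, ε n ≤ η → IsTruncatedSol p r σ η c d (W n) := fun n hn => by
      refine ⟨((hW n).mono hc0.le hd1.le).1, fun x hx => ?_⟩
      have hx' := hWη n hn x (Ioo_subset_Icc_self hx)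
      have := ((hW n).mono hc0.le hd1.le).2 x hx
      rwa [truncate_of_mem ⟨hn.trans hx'.1, hx'.2⟩, ← truncate_of_mem hx'] at this
    obtain ⟨Z, hZd, hZ⟩ := hp.exists_truncatedSol σ (V d) hη0 hηr (hsub ⟨hcd, le_rfl⟩)
    have hZ' := hZ.mono hc0.le hd1.le
    have hVZ : ∀ x ∈ Icc c d, V x = Z x := by
      intro x hx
      have hgap : Tendsto (fun n => |W n d - V d|) atTop (𝓝 0) := by
        simpa using ((hlim d (hsub ⟨hcd, le_rfl⟩)).sub_const (V d)).abs
      refine tendsto_nhds_unique (hlim x (hsub hx)) (tendsto_iff_norm_sub_tendsto_zero.2 ?_)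
      refine squeeze_zero' (Eventually.of_forall fun n => norm_nonneg _) ?_ hgap
      filter_upwards [hev] with n hn
      have h1 := hp.truncatedSol_le_add hη0 le_rfl hηr hc0.le hd1.le (hWsol n hn) hZ'
        (abs_nonneg (W n d - V d)) (by rw [hZd]; linarith [le_abs_self (W n d - V d)]) x hx
      have h2 := hp.truncatedSol_le_add hη0 le_rfl hηr hc0.le hd1.le hZ' (hWsol n hn)
        (abs_nonneg (W n d - V d)) (by rw [hZd]; linarith [neg_abs_le (W n d - V d)]) x hx
      rw [Real.norm_eq_abs, abs_le]
      constructor <;> linarith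
    have hucd : u ∈ Icc c d := ⟨hcu.le, hud.le⟩
    refine ⟨⟨hη0.trans_le (hVη u hucd).1, (hVleft u (hsub hucd)).trans_lt
      (mul_lt_of_lt_one_right hr hu.2)⟩, ?_⟩
    have hder := hZ'.2 u ⟨hcu, hud⟩
    rw [← hVZ u hucd, truncate_of_mem (hVη u hucd)] at hder
    exact hder.congr_of_eventuallyEq
      (Filter.eventuallyEq_of_mem (Icc_mem_nhds hcu hud) hVZ)
  have hVnonneg : ∀ u ∈ Ioc (0:ℝ) 1, 0 ≤ V u := fun u hu => by
    rcases hu.2.eq_or_lt with rfl | h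
    · exact hV1.ge
    · exact (hsol u ⟨hu.1, h⟩).1.1.le
  refine ⟨V, hV1, fun u hu => ?_, ?_, hsol⟩
  · rcases hu.2.eq_or_lt with rfl | h
    · rw [ContinuousWithinAt, hV1]
      have hlin : Tendsto (fun u : ℝ => r * (1 - u)) (𝓝[Ioc 0 1] 1) (𝓝 0) := by
        have : Continuous fun u : ℝ => r * (1 - u) := by fun_prop
        simpa using (this.tendsto 1).mono_left nhdsWithin_le_nhds
      refine squeeze_zero' ?_ ?_ hlin
      · filter_upwards [self_mem_nhdsWithin] with u hu using hVnonneg u hu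
      · filter_upwards [self_mem_nhdsWithin] with u hu using hVright u (Ioc_subset_Icc_self hu)
    · exact (hsol u ⟨hu.1, h⟩).2.continuousAt.continuousWithinAt
  · have hlin : Tendsto (fun u : ℝ => r * u) (𝓝[>] 0) (𝓝 0) := by
      have : Continuous fun u : ℝ => r * u := by fun_prop
      simpa using (this.tendsto 0).mono_left nhdsWithin_le_nhds
    have hmem : Ioc (0:ℝ) 1 ∈ 𝓝[>] (0:ℝ) := Ioc_mem_nhdsGT zero_lt_one
    refine squeeze_zero' ?_ ?_ hlin
    · filter_upwards [hmem] with u hu using hVnonneg u hu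
    · filter_upwards [hmem] with u hu using hVleft u (Ioc_subset_Icc_self hu)

end IsSingularRate

namespace FluxData

variable (F : FluxData)

lemma eventually_hasDerivAt_mem_Icc {p : ℝ × ℝ} (hp : p ∈ OmegaSet F.ω) :
    ∃ m > 0, ∃ M > 0, ∀ᶠ q in 𝓝[OmegaSet F.ω] p,
      ∃ d ∈ Icc m M, HasDerivAt (F.a q.1) d q.2 := by
  have hC1 : ContDiffWithinAt ℝ (0 + 1) (fun p : ℝ × ℝ => F.a p.1 p.2) (OmegaSet F.ω) p := by
    simpa using F.a_C1 p hp
  obtain ⟨U, hU, -, -, f', hf', hcont⟩ :=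
    (contDiffWithinAt_succ_iff_hasFDerivWithinAt' (by simp)).1 hC1
  rw [insert_eq_of_mem hp] at hU
  have hpartial : ∀ q ∈ U ∩ OmegaSet F.ω, ∃ d > 0, f' q (0, 1) = d ∧
      HasDerivAt (F.a q.1) d q.2 := by
    rintro ⟨u, s⟩ ⟨hqU, hq⟩
    obtain ⟨d, hd, hder⟩ := F.a_deriv_pos u s hq
    have hnhds : {t : ℝ | (u, t) ∈ OmegaSet F.ω} ∈ 𝓝 s := by
      have hopen : IsOpen {t : ℝ | ENNReal.ofReal |t| < F.ω u} :=
        isOpen_lt (ENNReal.continuous_ofReal.comp continuous_abs) continuous_const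
      filter_upwards [hopen.mem_nhds hq.2] with t ht using ⟨hq.1, ht⟩
    have hline : HasDerivWithinAt (fun t : ℝ => (u, t)) (0, 1)
        {t : ℝ | (u, t) ∈ OmegaSet F.ω} s :=
      ((hasDerivAt_const s u).prodMk (hasDerivAt_id s)).hasDerivWithinAt
    have := ((hf' (u, s) hqU).comp_hasDerivWithinAt s hline fun t ht => ht).hasDerivAt hnhds
    exact ⟨d, hd, this.unique hder, hder⟩
  obtain ⟨d, hd, hfd, -⟩ := hpartial p ⟨mem_of_mem_nhdsWithin hp hU, hp⟩
  have hlim : Tendsto (fun q => f' q (0, 1)) (𝓝[OmegaSet F.ω] p) (𝓝 d) := by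
    rw [← hfd]
    exact (hcont.continuousWithinAt.clm_apply continuousWithinAt_const)
  refine ⟨d / 2, by linarith, 2 * d, by linarith, ?_⟩
  filter_upwards [hU, self_mem_nhdsWithin,
    hlim.eventually (Icc_mem_nhds (show d / 2 < d by linarith) (show d < 2 * d by linarith))]
    with q hqU hq hmem
  obtain ⟨e, -, he, hder⟩ := hpartial q ⟨hqU, hq⟩
  exact ⟨e, he ▸ hmem, hder⟩

/-- Near the axis `s = 0`, the derivative `∂a/∂s` is bounded and bounded away from zero,
uniformly in `u`. -/
lemma exists_uniform_deriv_bounds : ∃ δ > 0, ∃ m > 0, ∃ M > 0, ∀ u ∈ Icc (0:ℝ) 1, ∀ s : ℝ,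
    |s| ≤ δ → (u, s) ∈ OmegaSet F.ω ∧ ∃ d ∈ Icc m M, HasDerivAt (F.a u) d s := by
  refine isCompact_Icc.induction_on (p := fun S => ∃ δ > 0, ∃ m > 0, ∃ M > 0, ∀ u ∈ S, ∀ s : ℝ,
    |s| ≤ δ → (u, s) ∈ OmegaSet F.ω ∧ ∃ d ∈ Icc m M, HasDerivAt (F.a u) d s) ?_ ?_ ?_ ?_
  · exact ⟨1, one_pos, 1, one_pos, 1, one_pos, by simp⟩
  · rintro S T hST ⟨δ, hδ, m, hm, M, hM, h⟩
    exact ⟨δ, hδ, m, hm, M, hM, fun u hu => h u (hST hu)⟩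
  · rintro S T ⟨δ₁, hδ₁, m₁, hm₁, M₁, hM₁, h₁⟩ ⟨δ₂, hδ₂, m₂, hm₂, M₂, hM₂, h₂⟩
    refine ⟨min δ₁ δ₂, lt_min hδ₁ hδ₂, min m₁ m₂, lt_min hm₁ hm₂, max M₁ M₂, lt_max_of_lt_left hM₁,
      ?_⟩
    rintro u (hu | hu) s hs
    · obtain ⟨h, d, hd, hder⟩ := h₁ u hu s (hs.trans (min_le_left _ _))
      exact ⟨h, d, ⟨(min_le_left _ _).trans hd.1, hd.2.trans (le_max_left _ _)⟩, hder⟩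
    · obtain ⟨h, d, hd, hder⟩ := h₂ u hu s (hs.trans (min_le_right _ _))
      exact ⟨h, d, ⟨(min_le_right _ _).trans hd.1, hd.2.trans (le_max_right _ _)⟩, hder⟩
  · intro u₀ hu₀
    have hmem : (u₀, (0:ℝ)) ∈ OmegaSet F.ω := ⟨hu₀, by simpa using F.ω_pos u₀ hu₀⟩
    obtain ⟨m, hm, M, hM, hev⟩ := F.eventually_hasDerivAt_mem_Icc hmem
    obtain ⟨ρ, hρ, hball⟩ := Metric.mem_nhdsWithin_iff.1 hev
    obtain ⟨y, hy0, hy⟩ := ENNReal.lt_iff_exists_real_btwn.1 (F.ω_pos u₀ hu₀)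
    have hy0' : 0 < y := ENNReal.ofReal_pos.1 hy.1
    refine ⟨Icc 0 1 ∩ {u | ENNReal.ofReal y < F.ω u} ∩ Metric.ball u₀ ρ,
      inter_mem (inter_mem self_mem_nhdsWithin (F.ω_lsc u₀ hu₀ _ hy.2))
        (mem_nhdsWithin_of_mem_nhds (Metric.ball_mem_nhds _ hρ)),
      min y (ρ / 2), lt_min hy0' (by linarith), m, hm, M, hM, ?_⟩
    rintro u ⟨⟨hu, hyu⟩, huρ⟩ s hs
    have hΩ : (u, s) ∈ OmegaSet F.ω :=
      ⟨hu, (ENNReal.ofReal_le_ofReal (hs.trans (min_le_left _ _))).trans_lt hyu⟩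
    refine ⟨hΩ, hball ⟨?_, hΩ⟩⟩
    rw [Metric.mem_ball, Prod.dist_eq]
    refine max_lt huρ ?_
    have := hs.trans (min_le_right _ _)
    simp only [Real.dist_eq, sub_zero]
    linarith

lemma strictMonoOn_a (u : ℝ) : StrictMonoOn (F.a u) {s | (u, s) ∈ OmegaSet F.ω} := by
  have hord : OrdConnected {s : ℝ | (u, s) ∈ OmegaSet F.ω} :=
    ⟨fun x hx y hy z hz => ⟨hx.1, by
      refine (ENNReal.ofReal_le_ofReal (abs_le_max_abs_abs hz.1 hz.2)).trans_lt ?_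
      rcases max_choice |x| |y| with h | h <;> rw [h]
      exacts [hx.2, hy.2]⟩⟩
  refine strictMonoOn_of_deriv_pos hord.convex (fun s hs => ?_) fun s hs => ?_
  · obtain ⟨d, -, hd⟩ := F.a_deriv_pos u s hs
    exact hd.continuousAt.continuousWithinAt
  · have hmem : s ∈ {s | (u, s) ∈ OmegaSet F.ω} := interior_subset hs
    obtain ⟨d, hpos, hd⟩ := F.a_deriv_pos u s hmem
    rwa [hd.deriv]

lemma a_zero {u : ℝ} (hu : u ∈ Icc (0:ℝ) 1) : F.a u 0 = 0 := by
  have := F.a_odd u 0 ⟨hu, by simpa using F.ω_pos u hu⟩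
  rw [neg_zero] at this
  linarith

lemma exists_lipschitz_f : ∃ K : ℝ, 0 ≤ K ∧
    ∀ u ∈ Icc (0:ℝ) 1, ∀ v ∈ Icc (0:ℝ) 1, |F.f u - F.f v| ≤ K * |u - v| := by
  have hcont : ContinuousOn (derivWithin F.f (Icc 0 1)) (Icc 0 1) :=
    F.f_C1.continuousOn_derivWithin (uniqueDiffOn_Icc zero_lt_one) le_rfl
  obtain ⟨K, hK⟩ := isCompact_Icc.exists_bound_of_continuousOn hcont
  have hK0 : 0 ≤ K := (norm_nonneg _).trans (hK 0 (left_mem_Icc.2 zero_le_one))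
  refine ⟨K, hK0, fun u hu v hv => ?_⟩
  have hlip := (convex_Icc (0:ℝ) 1).lipschitzOnWith_of_nnnorm_derivWithin_le (C := ⟨K, hK0⟩)
    (F.f_C1.differentiableOn one_ne_zero) (fun x hx => hK x hx)
  exact hlip.dist_le_mul u hu v hv

lemma f_nonneg {u : ℝ} (hu : u ∈ Icc (0:ℝ) 1) : 0 ≤ F.f u := by
  rcases hu.1.eq_or_lt with rfl | h0
  · exact F.f_zero.ge
  rcases hu.2.eq_or_lt with rfl | h1
  · exact F.f_one.ge
  exact (F.f_pos u ⟨h0, h1⟩).le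

/-- Uniform control of the inverse `g` near the axis `v = 0`. -/
lemma exists_g_bounds : ∃ r > 0, ∃ m > 0, ∃ M > 0,
    (∀ u ∈ Icc (0:ℝ) 1, ENNReal.ofReal r < F.aplus u) ∧
    (∀ u ∈ Icc (0:ℝ) 1, ∀ v ∈ Icc 0 r, v ≤ M * F.g u v ∧ m * F.g u v ≤ v) ∧
    (∀ u ∈ Icc (0:ℝ) 1, MonotoneOn (F.g u) (Icc 0 r)) ∧
    (∀ u ∈ Icc (0:ℝ) 1, ∀ v ∈ Icc 0 r, ∀ w ∈ Icc 0 r, m * |F.g u v - F.g u w| ≤ |v - w|) ∧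
    (∀ v ∈ Icc 0 r, ContinuousOn (fun u => F.g u v) (Icc 0 1)) := by
  obtain ⟨δ, hδ, m, hm, M, hM, H⟩ := F.exists_uniform_deriv_bounds
  have hΩ : ∀ u ∈ Icc (0:ℝ) 1, ∀ s ∈ Icc 0 δ, (u, s) ∈ OmegaSet F.ω := fun u hu s hs =>
    (H u hu s (by rw [abs_of_nonneg hs.1]; exact hs.2)).1
  have hder : ∀ u ∈ Icc (0:ℝ) 1, ∀ s ∈ Icc 0 δ, ∃ d ∈ Icc m M, HasDerivAt (F.a u) d s :=
    fun u hu s hs => (H u hu s (by rw [abs_of_nonneg hs.1]; exact hs.2)).2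
  have hcont : ∀ u ∈ Icc (0:ℝ) 1, ContinuousOn (F.a u) (Icc 0 δ) := fun u hu s hs => by
    obtain ⟨d, -, hd⟩ := hder u hu s hs
    exact hd.continuousAt.continuousWithinAt
  have hdiff : ∀ u ∈ Icc (0:ℝ) 1, DifferentiableOn ℝ (F.a u) (interior (Icc 0 δ)) :=
    fun u hu s hs => by
      obtain ⟨d, -, hd⟩ := hder u hu s (interior_subset hs)
      exact hd.differentiableAt.differentiableWithinAt
  have hlow : ∀ u ∈ Icc (0:ℝ) 1, ∀ s ∈ Icc 0 δ, ∀ t ∈ Icc 0 δ, s ≤ t →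
      m * (t - s) ≤ F.a u t - F.a u s := fun u hu =>
    (convex_Icc 0 δ).mul_sub_le_image_sub_of_le_deriv (hcont u hu) (hdiff u hu) fun s hs => by
      obtain ⟨d, hmem, hd⟩ := hder u hu s (interior_subset hs)
      rw [hd.deriv]
      exact hmem.1
  have hupp : ∀ u ∈ Icc (0:ℝ) 1, ∀ s ∈ Icc 0 δ, ∀ t ∈ Icc 0 δ, s ≤ t →
      F.a u t - F.a u s ≤ M * (t - s) := fun u hu =>
    (convex_Icc 0 δ).image_sub_le_mul_sub_of_deriv_le (hcont u hu) (hdiff u hu) fun s hs => by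
      obtain ⟨d, hmem, hd⟩ := hder u hu s (interior_subset hs)
      rw [hd.deriv]
      exact hmem.2
  have habs : ∀ u ∈ Icc (0:ℝ) 1, ∀ s ∈ Icc 0 δ, ∀ t ∈ Icc 0 δ,
      m * |s - t| ≤ |F.a u s - F.a u t| := by
    intro u hu s hs t ht
    rcases le_total s t with h | h
    · rw [abs_sub_comm, abs_sub_comm (F.a u s), abs_of_nonneg (sub_nonneg.2 h)]
      exact (hlow u hu s hs t ht h).trans (le_abs_self _)
    · rw [abs_of_nonneg (sub_nonneg.2 h)]
      exact (hlow u hu t ht s hs h).trans (le_abs_self _)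
  have h0δ : (0:ℝ) ∈ Icc 0 δ := ⟨le_rfl, hδ.le⟩
  have hδδ : δ ∈ Icc 0 δ := ⟨hδ.le, le_rfl⟩
  have haδ : ∀ u ∈ Icc (0:ℝ) 1, m * δ ≤ F.a u δ := fun u hu => by
    simpa [F.a_zero hu] using hlow u hu 0 h0δ δ hδδ hδ.le
  have hmδ : 0 < m * δ := mul_pos hm hδ
  set r : ℝ := m * δ / 2 with hr
  have hr0 : 0 < r := by positivity
  have hrlt : r < m * δ := by linarith
  have haplus : ∀ u ∈ Icc (0:ℝ) 1, ENNReal.ofReal r < F.aplus u := fun u hu => by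
    have h1 : ENNReal.ofReal r < ENNReal.ofReal (F.a u δ) :=
      (ENNReal.ofReal_lt_ofReal_iff (hmδ.trans_le (haδ u hu))).2 (hrlt.trans_le (haδ u hu))
    refine h1.trans_le ?_
    rw [F.aplus_def u hu]
    exact le_iSup₂_of_le δ ⟨hδ, hΩ u hu δ hδδ⟩ le_rfl
  have hgspec : ∀ u ∈ Icc (0:ℝ) 1, ∀ v ∈ Icc 0 r,
      (u, F.g u v) ∈ OmegaSet F.ω ∧ F.a u (F.g u v) = v := fun u hu v hv =>
    F.g_spec (u, v) ⟨hu, by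
      rw [abs_of_nonneg hv.1]
      exact (ENNReal.ofReal_le_ofReal hv.2).trans_lt (haplus u hu)⟩
  have hgmem : ∀ u ∈ Icc (0:ℝ) 1, ∀ v ∈ Icc 0 r, F.g u v ∈ Icc 0 δ := fun u hu v hv => by
    obtain ⟨h1, h2⟩ := hgspec u hu v hv
    have hmono := F.strictMonoOn_a u
    constructor
    · rw [← hmono.le_iff_le (hΩ u hu 0 h0δ) h1, h2, F.a_zero hu]
      exact hv.1
    · rw [← hmono.le_iff_le h1 (hΩ u hu δ hδδ), h2]
      exact hv.2.trans (hrlt.le.trans (haδ u hu))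
  refine ⟨r, hr0, m, hm, M, hM, haplus, fun u hu v hv => ?_, fun u hu v hv w hw hvw => ?_,
    fun u hu v hv w hw => ?_, fun v hv u₀ hu₀ => ?_⟩
  · have hg := hgmem u hu v hv
    have h1 := hlow u hu 0 h0δ _ hg hg.1
    have h2 := hupp u hu 0 h0δ _ hg hg.1
    rw [(hgspec u hu v hv).2, F.a_zero hu] at h1 h2
    constructor <;> linarith
  · rw [← (F.strictMonoOn_a u).le_iff_le (hgspec u hu v hv).1 (hgspec u hu w hw).1,
      (hgspec u hu v hv).2, (hgspec u hu w hw).2]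
    exact hvw
  · have := habs u hu _ (hgmem u hu v hv) _ (hgmem u hu w hw)
    rwa [(hgspec u hu v hv).2, (hgspec u hu w hw).2] at this
  · have hs := hgmem u₀ hu₀ v hv
    have hline : ContinuousOn (fun u => F.a u (F.g u₀ v)) (Icc 0 1) :=
      F.a_C1.continuousOn.comp (f := fun u : ℝ => (u, F.g u₀ v)) (by fun_prop)
        fun u hu => hΩ u hu _ hs
    have hgap : Tendsto (fun u => |v - F.a u (F.g u₀ v)| / m) (𝓝[Icc 0 1] u₀) (𝓝 0) := by
      have h := (((hline u₀ hu₀).tendsto.const_sub v).abs).div_const m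
      simpa [(hgspec u₀ hu₀ v hv).2] using h
    refine tendsto_iff_norm_sub_tendsto_zero.2
      (squeeze_zero' (Eventually.of_forall fun _ => norm_nonneg _) ?_ hgap)
    filter_upwards [self_mem_nhdsWithin] with u hu
    have := habs u hu _ (hgmem u hu v hv) _ hs
    rw [(hgspec u hu v hv).2] at this
    rw [Real.norm_eq_abs, le_div_iff₀ hm]
    linarith

/-- The rate `f/g` is singular in the sense of `IsSingularRate`. -/
lemma exists_isSingularRate : ∃ r C : ℝ,
    (∀ u ∈ Icc (0:ℝ) 1, ENNReal.ofReal r < F.aplus u) ∧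
      IsSingularRate (fun u v => F.f u / F.g u v) r C := by
  obtain ⟨r, hr, m, hm, M, hM, haplus, hbd, hmono, hlip, hcont⟩ := F.exists_g_bounds
  obtain ⟨K, hK0, hK⟩ := F.exists_lipschitz_f
  have hgpos : ∀ u ∈ Icc (0:ℝ) 1, ∀ v ∈ Ioc 0 r, 0 < F.g u v := fun u hu v hv =>
    pos_of_mul_pos_right (hv.1.trans_le (hbd u hu v (Ioc_subset_Icc_self hv)).1) hM.le
  have hmul : ∀ u ∈ Icc (0:ℝ) 1, ∀ v ∈ Ioc 0 r, F.f u / F.g u v * v ≤ M * F.f u :=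
    fun u hu v hv => by
      rw [div_mul_eq_mul_div, div_le_iff₀ (hgpos u hu v hv)]
      have := mul_le_mul_of_nonneg_left (hbd u hu v (Ioc_subset_Icc_self hv)).1 (F.f_nonneg hu)
      linarith
  refine ⟨r, M * K, haplus, hr, fun u hu v hv w hw hvw => ?_, fun v hv => ?_, fun ε hε => ?_,
    fun u hu v hv => div_nonneg (F.f_nonneg hu) (hgpos u hu v hv).le, by positivity,
    fun u hu v hv => ?_, fun u hu v hv => ?_, fun c d hc hcd hd => ?_⟩
  · exact div_le_div_of_nonneg_left (F.f_nonneg hu) (hgpos u hu v hv)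
      (hmono u hu (Ioc_subset_Icc_self hv) (Ioc_subset_Icc_self hw) hvw)
  · exact F.f_C1.continuousOn.div (hcont v (Ioc_subset_Icc_self hv))
      fun u hu => (hgpos u hu v hv).ne'
  · have hfK : ∀ u ∈ Icc (0:ℝ) 1, F.f u ≤ K := fun u hu => by
      have := hK u hu 0 (left_mem_Icc.2 zero_le_one)
      rw [F.f_zero, sub_zero, sub_zero, abs_of_nonneg hu.1] at this
      exact (le_abs_self _).trans (this.trans (mul_le_of_le_one_right hK0 hu.2))
    refine ⟨K / (m * (ε / M) ^ 2), by positivity, fun u hu v hv w hw => ?_⟩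
    have hv' : v ∈ Ioc 0 r := ⟨hε.trans_le hv.1, hv.2⟩
    have hw' : w ∈ Ioc 0 r := ⟨hε.trans_le hw.1, hw.2⟩
    have hgv := hgpos u hu v hv'
    have hgw := hgpos u hu w hw'
    have hgε : ∀ x ∈ Icc ε r, ε / M ≤ F.g u x := fun x hx => by
      rw [div_le_iff₀ hM]
      linarith [(hbd u hu x ⟨hε.le.trans hx.1, hx.2⟩).1, hx.1]
    have hprod : (ε / M) ^ 2 ≤ F.g u v * F.g u w := by
      rw [sq]
      exact mul_le_mul (hgε v hv) (hgε w hw) (by positivity) hgv.le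
    have hdiff : |F.g u w - F.g u v| ≤ |v - w| / m := by
      rw [le_div_iff₀ hm, abs_sub_comm]
      linarith [hlip u hu v (Ioc_subset_Icc_self hv') w (Ioc_subset_Icc_self hw')]
    have heq : F.f u / F.g u v - F.f u / F.g u w =
        F.f u * (F.g u w - F.g u v) / (F.g u v * F.g u w) := by
      field_simp
    rw [heq, abs_div, abs_mul, abs_of_nonneg (F.f_nonneg hu), abs_of_pos (mul_pos hgv hgw)]
    calc F.f u * |F.g u w - F.g u v| / (F.g u v * F.g u w)
        ≤ K * (|v - w| / m) / (ε / M) ^ 2 := by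
          refine div_le_div₀ (by positivity) ?_ (by positivity) hprod
          exact mul_le_mul (hfK u hu) hdiff (abs_nonneg _) hK0
      _ = K / (m * (ε / M) ^ 2) * |v - w| := by field_simp
  · refine (hmul u hu v hv).trans ?_
    have := hK u hu 0 (left_mem_Icc.2 zero_le_one)
    rw [F.f_zero, sub_zero, sub_zero, abs_of_nonneg hu.1] at this
    rw [mul_assoc]
    exact mul_le_mul_of_nonneg_left ((le_abs_self _).trans this) hM.le
  · refine (hmul u hu v hv).trans ?_
    have := hK u hu 1 (right_mem_Icc.2 zero_le_one)
    rw [F.f_one, sub_zero, abs_sub_comm, abs_of_nonneg (sub_nonneg.2 hu.2)] at this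
    rw [mul_assoc]
    exact mul_le_mul_of_nonneg_left ((le_abs_self _).trans this) hM.le
  · have hsub : Icc c d ⊆ Icc (0:ℝ) 1 := Icc_subset_Icc hc.le hd.le
    obtain ⟨x, hx, hmin⟩ := isCompact_Icc.exists_isMinOn (nonempty_Icc.2 hcd)
      (F.f_C1.continuousOn.mono hsub)
    have hfx : 0 < F.f x := F.f_pos x ⟨hc.trans_le hx.1, hx.2.trans_lt hd⟩
    refine ⟨m * F.f x, mul_pos hm hfx, fun u hu v hv => ?_⟩
    have hu' := hsub hu
    rw [div_mul_eq_mul_div, le_div_iff₀ (hgpos u hu' v hv)]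
    have h1 : F.f x ≤ F.f u := hmin hu
    calc m * F.f x * F.g u v = F.f x * (m * F.g u v) := by ring
      _ ≤ F.f u * v := mul_le_mul h1 (hbd u hu' v (Ioc_subset_Icc_self hv)).2
          (mul_nonneg hm.le (hgpos u hu' v hv).le) (F.f_nonneg hu')

end FluxData

theorem stmt3 (F : FluxData) :
    ∃ σ₁ : ℝ, 0 < σ₁ ∧ ∀ σ : ℝ, σ₁ < σ →
      ∃ V : ℝ → ℝ, IsRightSolution F σ 0 V ∧
        Filter.Tendsto V (nhdsWithin 0 (Set.Ioi 0)) (nhds 0) := by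
  obtain ⟨r, C, haplus, hp⟩ := F.exists_isSingularRate
  have hr := hp.r_pos
  refine ⟨r + C / r, add_pos_of_pos_of_nonneg hr (div_nonneg hp.C_nonneg hr.le), fun σ hσ => ?_⟩
  obtain ⟨V, hV1, hcont, hlim, hV⟩ := hp.exists_solution hσ
  refine ⟨V, ⟨left_mem_Ico.2 zero_lt_one, hcont, hV1, fun u hu => ?_⟩, hlim⟩
  obtain ⟨hmem, hder⟩ := hV u hu
  have hu' := Ioo_subset_Icc_self hu
  refine ⟨hmem.1, ⟨hu', ?_⟩, hder⟩
  rw [abs_of_pos hmem.1]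
  exact (ENNReal.ofReal_le_ofReal hmem.2.le).trans_lt (haplus u hu')
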